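/- arXiv:1005.2250 — 5 statements merged into one kernel-verified Lean document; each statement's English description precedes it below -/
import Mathlib

section
/- Let F be a finite field of order q = p^f and for α ∈ F let θ_α ∈ GL(4,F) be the matrix with 1's on the diagonal, entries −α at (2,1), −α² at (3,1), α at (3,2), α at (4,3), and 0 elsewhere. Then for every integer n ≥ 1, the power θ_α^n is the matrix with 1's on the diagonal and entries −nα at (2,1), −(n(n+1)/2)α² at (3,1), nα at (3,2), −(n(n²−1)/6)α³ at (4,1), (n(n−1)/2)α² at (4,2), nα at (4,3), and 0 elsewhere, where the integer coefficients n, n(n+1)/2, n(n²−1)/6, n(n−1)/2 are interpreted in F via the natural ring map ℤ → F. -/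
open Matrix

variable (F : Type) [Field F]

/-- The matrix `t_{a,b,c}`: 1's on the diagonal, `-c` in position (2,1), `b` in (3,1),
`a` in (4,1), `b` in (4,2), `c` in (4,3), and 0 elsewhere. -/
def tMat (a b c : F) : Matrix (Fin 4) (Fin 4) F :=
  !![1, 0, 0, 0;
     -c, 1, 0, 0;
     b, 0, 1, 0;
     a, b, c, 1]

lemma tMat_mul_neg (a b c : F) : tMat F a b c * tMat F (-a) (-b) (-c) = 1 := by
  ext i j
  fin_cases i <;> fin_cases j <;>
    simp [tMat, Matrix.mul_apply, Fin.sum_univ_four, Matrix.one_apply,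
      Matrix.vecHead, Matrix.vecTail] <;> ring

/-- The element `t_{a,b,c}` of `GL(4,F)`. -/
def tGL (a b c : F) : GL (Fin 4) F :=
  ⟨tMat F a b c, tMat F (-a) (-b) (-c), tMat_mul_neg F a b c, by
    simpa using tMat_mul_neg F (-a) (-b) (-c)⟩

/-- The matrix `θ_α`: 1's on the diagonal, `-α` in position (2,1), `-α²` in (3,1),
`α` in (3,2), `α` in (4,3), and 0 elsewhere. -/
def thetaMat (α : F) : Matrix (Fin 4) (Fin 4) F :=
  !![1, 0, 0, 0;
     -α, 1, 0, 0;
     -α^2, α, 1, 0;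
     0, 0, α, 1]

def thetaInvMat (α : F) : Matrix (Fin 4) (Fin 4) F :=
  !![1, 0, 0, 0;
     α, 1, 0, 0;
     0, -α, 1, 0;
     0, α^2, -α, 1]

/-- The element `θ_α` of `GL(4,F)`. -/
def thetaGL (α : F) : GL (Fin 4) F :=
  ⟨thetaMat F α, thetaInvMat F α,
   by ext i j; fin_cases i <;> fin_cases j <;>
        simp [thetaMat, thetaInvMat, Matrix.mul_apply, Fin.sum_univ_four, Matrix.one_apply,
          Matrix.vecHead, Matrix.vecTail] <;> ring,
   by ext i j; fin_cases i <;> fin_cases j <;>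
        simp [thetaMat, thetaInvMat, Matrix.mul_apply, Fin.sum_univ_four, Matrix.one_apply,
          Matrix.vecHead, Matrix.vecTail] <;> ring⟩

lemma Int.succ_mul_add_one_ediv_two (n : ℤ) :
    (n + 1) * (n + 1 + 1) / 2 = n * (n + 1) / 2 + n + 1 := by
  rw [show (n + 1) * (n + 1 + 1) = n * (n + 1) + (n + 1) * 2 by ring,
    Int.add_mul_ediv_right _ _ two_ne_zero, add_assoc]

lemma Int.succ_mul_sub_one_ediv_two (n : ℤ) :
    (n + 1) * (n + 1 - 1) / 2 = n * (n - 1) / 2 + n := by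
  rw [show (n + 1) * (n + 1 - 1) = n * (n - 1) + n * 2 by ring,
    Int.add_mul_ediv_right _ _ two_ne_zero]

lemma Int.succ_mul_sq_sub_one_ediv_six (n : ℤ) :
    (n + 1) * ((n + 1) ^ 2 - 1) / 6 = n * (n ^ 2 - 1) / 6 + n * (n - 1) / 2 + n := by
  obtain ⟨k, hk⟩ := (Int.even_mul_pred_self n).two_dvd
  rw [show (n + 1) * ((n + 1) ^ 2 - 1) = n * (n ^ 2 - 1) + (k + n) * 6 by
      linear_combination 3 * hk,
    Int.add_mul_ediv_right _ _ (by norm_num), hk, Int.mul_ediv_cancel_left _ two_ne_zero,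
    add_assoc]

/-- For every integer `n ≥ 1`, `θ_α^n` is the stated lower-triangular matrix, where the
integer coefficients `n`, `n(n+1)/2`, `n(n²−1)/6`, `n(n−1)/2` are interpreted in `F`
via the natural ring map `ℤ → F`. -/
theorem thetaMat_pow (p fdeg : ℕ) (hp : p.Prime) [Fintype F]
    (hF : Fintype.card F = p ^ fdeg) (α : F) (n : ℕ) (hn : 1 ≤ n) :
    thetaMat F α ^ n =
      !![1, 0, 0, 0;
         -(((n : ℤ) : F) * α), 1, 0, 0;
         -(((((n : ℤ) * ((n : ℤ) + 1)) / 2 : ℤ) : F) * α ^ 2), ((n : ℤ) : F) * α, 1, 0;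
         -(((((n : ℤ) * ((n : ℤ) ^ 2 - 1)) / 6 : ℤ) : F) * α ^ 3),
           ((((n : ℤ) * ((n : ℤ) - 1)) / 2 : ℤ) : F) * α ^ 2, ((n : ℤ) : F) * α, 1] := by
  clear hn
  induction n with
  | zero => ext i j; fin_cases i <;> fin_cases j <;> simp
  | succ n ih =>
    rw [pow_succ, ih, Nat.cast_succ, Int.succ_mul_add_one_ediv_two,
      Int.succ_mul_sub_one_ediv_two, Int.succ_mul_sq_sub_one_ediv_six, thetaMat]
    generalize (n : ℤ) * (n + 1) / 2 = a
    generalize (n : ℤ) * (n - 1) / 2 = b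
    generalize (n : ℤ) * (n ^ 2 - 1) / 6 = c
    ext i j
    fin_cases i <;> fin_cases j <;> simp [Matrix.mul_apply, Fin.sum_univ_four] <;> ring
end

section
/- Let F be a finite field of order q = p^f, and let t_{a,b,c}, θ_α ∈ GL(4,F) be as defined. Then for all a,b,c,α ∈ F: (i) θ_α^{-1} t_{a,b,c} θ_α = t_{−2α²c−2αb+a, αc+b, c}; (ii) [t_{a,b,c}, θ_α] = t_{−α(c²+2αc+2b), αc, 0}, where [g,h] = g^{-1}h^{-1}gh. -/
open Matrix

variable (F : Type) [Field F]

lemma tGL_mul (a b c a' b' c' : F) :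
    tGL F a b c * tGL F a' b' c' = tGL F (a + a' - b * c' + c * b') (b + b') (c + c') := by
  ext i j
  fin_cases i <;> fin_cases j <;>
    simp [tGL, tMat, Matrix.mul_apply, Fin.sum_univ_four] <;> ring

lemma tGL_inv (a b c : F) : (tGL F a b c)⁻¹ = tGL F (-a) (-b) (-c) :=
  inv_eq_of_mul_eq_one_right (Units.ext (tMat_mul_neg F a b c))

lemma tGL_mul_thetaGL (a b c α : F) :
    tGL F a b c * thetaGL F α =
      thetaGL F α * tGL F (-(2 * α ^ 2 * c) - 2 * α * b + a) (α * c + b) c := by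
  ext i j
  fin_cases i <;> fin_cases j <;>
    simp [tGL, thetaGL, tMat, thetaMat, Matrix.mul_apply, Fin.sum_univ_four] <;> ring

lemma thetaGL_conj_tGL (a b c α : F) :
    (thetaGL F α)⁻¹ * tGL F a b c * thetaGL F α =
      tGL F (-(2 * α ^ 2 * c) - 2 * α * b + a) (α * c + b) c := by
  rw [mul_assoc, tGL_mul_thetaGL, inv_mul_cancel_left]

/-- (i) `θ_α⁻¹ t_{a,b,c} θ_α = t_{−2α²c−2αb+a, αc+b, c}`;
(ii) `[t_{a,b,c}, θ_α] = t_{−α(c²+2αc+2b), αc, 0}`, where `[g,h] = g⁻¹h⁻¹gh`. -/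
theorem theta_t_relations (p fdeg : ℕ) (hp : p.Prime) [Fintype F]
    (hF : Fintype.card F = p ^ fdeg) (a b c α : F) :
    (thetaGL F α)⁻¹ * tGL F a b c * thetaGL F α =
      tGL F (-(2 * α ^ 2 * c) - 2 * α * b + a) (α * c + b) c ∧
    (tGL F a b c)⁻¹ * (thetaGL F α)⁻¹ * tGL F a b c * thetaGL F α =
      tGL F (-α * (c ^ 2 + 2 * α * c + 2 * b)) (α * c) 0 := by
  refine ⟨thetaGL_conj_tGL F a b c α, ?_⟩
  rw [mul_assoc, mul_assoc, ← mul_assoc (thetaGL F α)⁻¹, thetaGL_conj_tGL, tGL_inv, tGL_mul]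
  congr 1 <;> ring
end

section
/- Let F be a finite field of order q = p^f, and let t_{a,b,c}, θ_α ∈ GL(4,F) be as defined. Then for all α,β ∈ F: (i) θ_α θ_β = t_{α²β, αβ, 0} · θ_{α+β}; (ii) [θ_α, θ_β] = t_{αβ(α−β), 0, 0}, where [g,h] = g^{-1}h^{-1}gh. -/
open Matrix

variable (F : Type) [Field F]

/-- (i) `θ_α θ_β = t_{α²β, αβ, 0} · θ_{α+β}`;
(ii) `[θ_α, θ_β] = t_{αβ(α−β), 0, 0}`, where `[g,h] = g⁻¹h⁻¹gh`. -/
theorem theta_theta_relations (p fdeg : ℕ) (hp : p.Prime) [Fintype F]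
    (hF : Fintype.card F = p ^ fdeg) (α β : F) :
    thetaGL F α * thetaGL F β = tGL F (α ^ 2 * β) (α * β) 0 * thetaGL F (α + β) ∧
    (thetaGL F α)⁻¹ * (thetaGL F β)⁻¹ * thetaGL F α * thetaGL F β =
      tGL F (α * β * (α - β)) 0 0 := by
  constructor
  · ext i j
    fin_cases i <;> fin_cases j <;>
      simp [thetaGL, tGL, thetaMat, tMat, Matrix.mul_apply, Fin.sum_univ_four] <;> ring
  · rw [mul_assoc, mul_assoc, inv_mul_eq_iff_eq_mul, inv_mul_eq_iff_eq_mul, ← mul_assoc]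
    ext i j
    fin_cases i <;> fin_cases j <;>
      simp [thetaGL, tGL, thetaMat, tMat, Matrix.mul_apply, Fin.sum_univ_four] <;> ring
end

section
/- Let F be a finite field of order q = 2^f with f ≥ 2. If f ≥ 3 then {αβ(α+β) : α, β ∈ F} = F, while if f = 2 (so F has order 4) then {αβ(α+β) : α, β ∈ F} = {0, 1}. -/
theorem exists_notMem_of_card_lt {α : Type*} [Fintype α] {s : Finset α}
    (h : s.card < Fintype.card α) : ∃ a, a ∉ s := by
  by_contra! hs
  exact h.ne (Finset.card_eq_iff_eq_univ s |>.2 (Finset.eq_univ_iff_forall.2 hs))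

/-- The additive map `t ↦ t ^ 2 + t` in characteristic two. -/
def artinSchreierHom (F : Type*) [Field F] [CharP F 2] : F →+ F where
  toFun t := t ^ 2 + t
  map_zero' := by simp
  map_add' s t := by
    rw [CharTwo.add_sq]
    ring

theorem artinSchreierHom_apply {F : Type*} [Field F] [CharP F 2] (t : F) :
    artinSchreierHom F t = t ^ 2 + t := rfl

theorem artinSchreierHom_eq_zero_iff {F : Type*} [Field F] [CharP F 2] (t : F) :
    artinSchreierHom F t = 0 ↔ t = 0 ∨ t = 1 := by
  rw [artinSchreierHom_apply, show t ^ 2 + t = t * (t + 1) by ring, mul_eq_zero,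
    CharTwo.add_eq_zero]

theorem index_range_artinSchreierHom (F : Type*) [Field F] [Finite F] [CharP F 2] :
    (artinSchreierHom F).range.index = 2 := by
  have hker : Nat.card (artinSchreierHom F).ker = 2 := by
    have h : ((artinSchreierHom F).ker : Set F) = {0, 1} := by
      ext t
      simp [AddMonoidHom.mem_ker, artinSchreierHom_eq_zero_iff]
    rw [← SetLike.coe_sort_coe, h, Nat.card_coe_set_eq, Set.ncard_pair zero_ne_one]
  rw [AddSubgroup.index_range, hker]

/-- Among the multiples `c * x ^ 3` with `x ≠ 0`, at least one has the form `t ^ 2 + t`, provided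
that the field has more than four elements. -/
theorem exists_mul_cube_eq_sq_add_self {F : Type*} [Field F] [Fintype F] [CharP F 2]
    (hF : 4 < Fintype.card F) (c : F) : ∃ x t : F, x ≠ 0 ∧ c * x ^ 3 = t ^ 2 + t := by
  classical
  obtain ⟨y, hy⟩ : ∃ y, y ∉ ({0, 1} : Finset F) :=
    exists_notMem_of_card_lt (Finset.card_le_two.trans_lt (by omega))
  obtain ⟨z, hz⟩ : ∃ z, z ∉ ({0, 1, y, 1 + y} : Finset F) :=
    exists_notMem_of_card_lt (Finset.card_le_four.trans_lt hF)
  simp only [Finset.mem_insert, Finset.mem_singleton, not_or] at hy hz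
  obtain ⟨hy₀, hy₁⟩ := hy
  obtain ⟨hz₀, hz₁, hzy, hzy₁⟩ := hz
  by_contra! hcon
  set H := (artinSchreierHom F).range
  have hH (x : F) (hx : x ≠ 0) : c * x ^ 3 ∉ H := by
    rintro ⟨t, ht⟩
    exact hcon x t hx ht.symm
  have hadd (a b : F) : a + b ∈ H ↔ (a ∈ H ↔ b ∈ H) :=
    AddSubgroup.add_mem_iff_of_index_two (index_range_artinSchreierHom F)
  have hsum : c * 1 ^ 3 + c * y ^ 3 + c * z ^ 3 + c * (1 + y) ^ 3 + c * (1 + z) ^ 3 +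
      c * (y + z) ^ 3 + c * (1 + y + z) ^ 3 = 0 := by
    linear_combination (c * (2 + 2 * y ^ 3 + 2 * z ^ 3 + 3 * y + 3 * y ^ 2 + 3 * z + 3 * z ^ 2 +
      3 * y ^ 2 * z + 3 * y * z ^ 2 + 3 * y * z)) * CharTwo.two_eq_zero (R := F)
  have h₀ := H.zero_mem
  rw [← hsum] at h₀
  simp only [hadd, hH 1 one_ne_zero, hH y hy₀, hH z hz₀,
    hH (1 + y) (mt CharTwo.add_eq_zero.1 (Ne.symm hy₁)),
    hH (1 + z) (mt CharTwo.add_eq_zero.1 (Ne.symm hz₁)),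
    hH (y + z) (mt CharTwo.add_eq_zero.1 (Ne.symm hzy)),
    hH (1 + y + z) (mt CharTwo.add_eq_zero.1 (Ne.symm hzy₁))] at h₀
  tauto

/-- For a finite field `F` of order `2^f` with `f ≥ 2`: if `f ≥ 3` then
`{αβ(α+β) : α,β ∈ F} = F`, while if `f = 2` then this set is `{0, 1}`. -/
theorem field_cube_like_set (fdeg : ℕ) (hf : 2 ≤ fdeg) (F : Type) [Field F] [Fintype F]
    (hF : Fintype.card F = 2 ^ fdeg) :
    (3 ≤ fdeg → {x : F | ∃ α β : F, x = α * β * (α + β)} = Set.univ) ∧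
    (fdeg = 2 → {x : F | ∃ α β : F, x = α * β * (α + β)} = {0, 1}) := by
  classical
  have : CharP F 2 := charP_of_card_eq_prime_pow hF
  refine ⟨fun h3 => Set.eq_univ_of_forall fun c => ?_, ?_⟩
  · have hcard : 4 < Fintype.card F := by
      have := Nat.pow_le_pow_right two_pos h3
      omega
    obtain ⟨x, t, hx, h⟩ := exists_mul_cube_eq_sq_add_self hcard c
    refine ⟨t / x, 1 / x, ?_⟩
    field_simp
    linear_combination h
  · rintro rfl
    have hpow (a : F) : a ^ 4 = a := by
      simpa [hF] using FiniteField.pow_card a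
    have hmem (a b : F) : a * b * (a + b) = 0 ∨ a * b * (a + b) = 1 := by
      rw [← artinSchreierHom_eq_zero_iff, artinSchreierHom_apply]
      linear_combination b ^ 2 * hpow a + a ^ 2 * hpow b +
        (a ^ 3 * b ^ 3 + a ^ 2 * b + a * b ^ 2) * CharTwo.two_eq_zero (R := F)
    ext c
    simp only [Set.mem_ofPred_eq, Set.mem_insert_iff, Set.mem_singleton_iff]
    constructor
    · rintro ⟨a, b, rfl⟩
      exact hmem a b
    · rintro (rfl | rfl)
      · exact ⟨0, 0, by simp⟩
      · obtain ⟨y, hy⟩ : ∃ y, y ∉ ({0, 1} : Finset F) :=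
          exists_notMem_of_card_lt (Finset.card_le_two.trans_lt (by omega))
        simp only [Finset.mem_insert, Finset.mem_singleton, not_or] at hy
        refine ⟨1, y, ((hmem 1 y).resolve_left ?_).symm⟩
        simp [hy.1, CharTwo.add_eq_zero, Ne.symm hy.2]
end

section
/- Let K = GF(2), let A = [[0,1],[1,1]] ∈ GL(2,K) (an element of order 3 preserving the anisotropic form x² + xy + y²), let I be the 2×2 identity, and let G ≤ GL(6,K) be the subgroup generated by the three 6×6 block matrices diag(A, A^{-1}, I), diag(I, A, A^{-1}), and the block permutation matrix [[0,I,0],[0,0,I],[I,0,0]]. Let Q be the quadratic form on K⁶ given by Q(y) = y₁² + y₁y₂ + y₂² + y₃² + y₃y₄ + y₄² + y₅² + y₅y₆ + y₆². Then G is an extraspecial group of order 27 and exponent 3, every element of G preserves Q, and G acts freely and transitively on the 27 nonzero vectors v ∈ K⁶ with Q(v) = 0 (i.e. G acts regularly on the points of the elliptic quadric Q⁻(5,2)). -/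
open Matrix

/-- The elliptic quadratic form `Q(y) = y₁² + y₁y₂ + y₂² + y₃² + y₃y₄ + y₄² + y₅² + y₅y₆ + y₆²`
on `GF(2)⁶`. -/
def Qform (y : Fin 6 → ZMod 2) : ZMod 2 :=
  y 0 ^ 2 + y 0 * y 1 + y 1 ^ 2 + y 2 ^ 2 + y 2 * y 3 + y 3 ^ 2 +
    y 4 ^ 2 + y 4 * y 5 + y 5 ^ 2

/-- `diag(A, A⁻¹, I)`, where `A = [[0,1],[1,1]]`. -/
def M1 : GL (Fin 6) (ZMod 2) :=
  ⟨!![0,1,0,0,0,0; 1,1,0,0,0,0; 0,0,1,1,0,0; 0,0,1,0,0,0; 0,0,0,0,1,0; 0,0,0,0,0,1],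
   !![1,1,0,0,0,0; 1,0,0,0,0,0; 0,0,0,1,0,0; 0,0,1,1,0,0; 0,0,0,0,1,0; 0,0,0,0,0,1],
   by decide, by decide⟩

/-- `diag(I, A, A⁻¹)`. -/
def M2 : GL (Fin 6) (ZMod 2) :=
  ⟨!![1,0,0,0,0,0; 0,1,0,0,0,0; 0,0,0,1,0,0; 0,0,1,1,0,0; 0,0,0,0,1,1; 0,0,0,0,1,0],
   !![1,0,0,0,0,0; 0,1,0,0,0,0; 0,0,1,1,0,0; 0,0,1,0,0,0; 0,0,0,0,0,1; 0,0,0,0,1,1],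
   by decide, by decide⟩

/-- The block permutation matrix `[[0,I,0],[0,0,I],[I,0,0]]`. -/
def M3 : GL (Fin 6) (ZMod 2) :=
  ⟨!![0,0,1,0,0,0; 0,0,0,1,0,0; 0,0,0,0,1,0; 0,0,0,0,0,1; 1,0,0,0,0,0; 0,1,0,0,0,0],
   !![0,0,0,0,1,0; 0,0,0,0,0,1; 1,0,0,0,0,0; 0,1,0,0,0,0; 0,0,1,0,0,0; 0,0,0,1,0,0],
   by decide, by decide⟩

/-- The group `G = ⟨diag(A,A⁻¹,I), diag(I,A,A⁻¹), blockperm⟩ ≤ GL(6, GF(2))`. -/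
def Gsub : Subgroup (GL (Fin 6) (ZMod 2)) := Subgroup.closure {M1, M2, M3}

/-- The Heisenberg group over `R`, where `⟨k, a, c⟩` stands for `uᵏ vᵃ wᶜ` with `u` central
and `w v = u v w`. -/
@[ext]
structure Heis (R : Type*) where
  /-- The exponent of the central generator. -/
  k : R
  /-- The exponent of the first non-central generator. -/
  a : R
  /-- The exponent of the second non-central generator. -/
  c : R

open scoped commutatorElement

namespace Heis

variable {R : Type*} [CommRing R]

instance : Mul (Heis R) := ⟨fun x y => ⟨x.k + y.k + x.c * y.a, x.a + y.a, x.c + y.c⟩⟩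

instance : One (Heis R) := ⟨⟨0, 0, 0⟩⟩

instance : Inv (Heis R) := ⟨fun x => ⟨-x.k + x.c * x.a, -x.a, -x.c⟩⟩

@[simp] theorem mul_k (x y : Heis R) : (x * y).k = x.k + y.k + x.c * y.a := rfl
@[simp] theorem mul_a (x y : Heis R) : (x * y).a = x.a + y.a := rfl
@[simp] theorem mul_c (x y : Heis R) : (x * y).c = x.c + y.c := rfl
@[simp] theorem one_k : (1 : Heis R).k = 0 := rfl
@[simp] theorem one_a : (1 : Heis R).a = 0 := rfl
@[simp] theorem one_c : (1 : Heis R).c = 0 := rfl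
@[simp] theorem inv_k (x : Heis R) : (x⁻¹).k = -x.k + x.c * x.a := rfl
@[simp] theorem inv_a (x : Heis R) : (x⁻¹).a = -x.a := rfl
@[simp] theorem inv_c (x : Heis R) : (x⁻¹).c = -x.c := rfl

instance : Group (Heis R) :=
  Group.ofLeftAxioms
    (fun x y z => by ext <;> simp <;> ring)
    (fun x => by ext <;> simp)
    (fun x => by ext <;> simp)

/-- The Heisenberg group as a set of triples. -/
def equivProd (R : Type*) : Heis R ≃ R × R × R where
  toFun x := (x.k, x.a, x.c)
  invFun p := ⟨p.1, p.2.1, p.2.2⟩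
  left_inv _ := rfl
  right_inv _ := rfl

theorem natCard (R : Type*) : Nat.card (Heis R) = Nat.card R ^ 3 := by
  rw [Nat.card_congr (equivProd R), Nat.card_prod, Nat.card_prod]
  ring

/-- The first coordinate of the abelianization of the Heisenberg group. -/
def aHom : Heis R →* Multiplicative R where
  toFun x := Multiplicative.ofAdd x.a
  map_one' := rfl
  map_mul' _ _ := rfl

/-- The second coordinate of the abelianization of the Heisenberg group. -/
def cHom : Heis R →* Multiplicative R where
  toFun x := Multiplicative.ofAdd x.c
  map_one' := rfl
  map_mul' _ _ := rfl

theorem mem_center_iff {x : Heis R} : x ∈ Subgroup.center (Heis R) ↔ x.a = 0 ∧ x.c = 0 := by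
  rw [Subgroup.mem_center_iff]
  constructor
  · intro h
    have h₁ := congrArg k (h ⟨0, 0, 1⟩)
    have h₂ := congrArg k (h ⟨0, 1, 0⟩)
    simp at h₁ h₂
    exact ⟨h₁, h₂⟩
  · rintro ⟨ha, hc⟩ y
    ext <;> simp [ha, hc, add_comm]

theorem natCard_center (R : Type*) [CommRing R] :
    Nat.card (Subgroup.center (Heis R)) = Nat.card R :=
  Nat.card_congr
    { toFun x := x.1.k
      invFun r := ⟨⟨r, 0, 0⟩, mem_center_iff.2 ⟨rfl, rfl⟩⟩
      left_inv x := by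
        obtain ⟨x, hx⟩ := x
        obtain ⟨ha, hc⟩ := mem_center_iff.1 hx
        ext <;> simp [ha, hc]
      right_inv _ := rfl }

theorem commutator_eq_center (R : Type*) [CommRing R] :
    commutator (Heis R) = Subgroup.center (Heis R) := by
  apply le_antisymm
  · rw [commutator_def, Subgroup.commutator_le]
    intro x _ y _
    rw [mem_center_iff]
    simp [commutatorElement_def]
  · intro x hx
    obtain ⟨ha, hc⟩ := mem_center_iff.1 hx
    have : x = ⁅(⟨0, 0, x.k⟩ : Heis R), ⟨0, 1, 0⟩⁆ := by
      ext <;> simp [commutatorElement_def, ha, hc]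
    rw [this]
    exact Subgroup.commutator_mem_commutator (Subgroup.mem_top _) (Subgroup.mem_top _)

end Heis

theorem commutator_inf_center_le_frattini (G : Type*) [Group G] :
    commutator G ⊓ Subgroup.center G ≤ frattini G := by
  refine le_iInf₂ fun M (hM : IsCoatom M) => ?_
  by_cases hZ : Subgroup.center G ≤ M
  · exact inf_le_right.trans hZ
  refine inf_le_left.trans ?_
  have hsup : M ⊔ Subgroup.center G = ⊤ :=
    hM.2 _ (lt_of_le_of_ne le_sup_left fun h => hZ (h ▸ le_sup_right))
  rw [commutator_def, Subgroup.commutator_le]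
  intro x _ y _
  obtain ⟨m, hm, z, hz, rfl⟩ := Subgroup.mem_sup_of_normal_right.1
    (show x ∈ M ⊔ Subgroup.center G by simp [hsup])
  obtain ⟨n, hn, t, ht, rfl⟩ := Subgroup.mem_sup_of_normal_right.1
    (show y ∈ M ⊔ Subgroup.center G by simp [hsup])
  have hz := Subgroup.mem_center_iff.1 hz
  have ht := Subgroup.mem_center_iff.1 ht
  have : ⁅m * z, n * t⁆ = ⁅m, n⁆ := by
    rw [commutatorElement_def, commutatorElement_def, mul_inv_eq_iff_eq_mul,
      mul_inv_eq_iff_eq_mul]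
    calc m * z * (n * t) = m * (z * n) * t := by group
      _ = m * n * z * t := by rw [← hz n]; group
      _ = m * n * m⁻¹ * n⁻¹ * n * (m * z) * t := by group
      _ = m * n * m⁻¹ * n⁻¹ * (n * t) * (m * z) := by
        rw [mul_assoc _ (m * z) t, ht (m * z)]; group
  rw [this, commutatorElement_def]
  exact mul_mem (mul_mem (mul_mem hm hn) (inv_mem hm)) (inv_mem hn)

theorem frattini_eq_bot_of_isSimpleGroup (G : Type*) [CommGroup G] [IsSimpleGroup G] :
    frattini G = ⊥ :=
  le_bot_iff.1 (frattini_le_coatom isCoatom_bot)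

theorem isSimpleGroup_multiplicative_zmod (p : ℕ) [hp : Fact p.Prime] :
    IsSimpleGroup (Multiplicative (ZMod p)) :=
  isSimpleGroup_of_prime_card (p := p) (by simp)

theorem Heis.frattini_eq_center (p : ℕ) [Fact p.Prime] :
    frattini (Heis (ZMod p)) = Subgroup.center (Heis (ZMod p)) := by
  have := isSimpleGroup_multiplicative_zmod p
  apply le_antisymm
  · intro x hx
    have ha := frattini_le_comap_frattini_of_surjective (φ := Heis.aHom (R := ZMod p))
      (fun r => ⟨⟨0, r.toAdd, 0⟩, rfl⟩) hx
    have hc := frattini_le_comap_frattini_of_surjective (φ := Heis.cHom (R := ZMod p))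
      (fun r => ⟨⟨0, 0, r.toAdd⟩, rfl⟩) hx
    rw [frattini_eq_bot_of_isSimpleGroup] at ha hc
    exact Heis.mem_center_iff.2 ⟨ha, hc⟩
  · simpa [Heis.commutator_eq_center] using commutator_inf_center_le_frattini (Heis (ZMod p))

theorem Heis.exponent_three : Monoid.exponent (Heis (ZMod 3)) = 3 := by
  have hdvd : Monoid.exponent (Heis (ZMod 3)) ∣ 3 := by
    refine Monoid.exponent_dvd_of_forall_pow_eq_one ?_
    rintro ⟨k, a, c⟩
    have h : ∀ r : ZMod 3, r + r + r = 0 := by decide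
    have hk : k + k + c * a + k + (c + c) * a = (k + k + k) + (c * a + c * a + c * a) := by ring
    ext <;> simp [pow_succ, h, hk]
  refine ((Nat.dvd_prime Nat.prime_three).1 hdvd).resolve_left fun h => ?_
  have h₁ := Monoid.pow_exponent_eq_one (⟨1, 0, 0⟩ : Heis (ZMod 3))
  rw [h, pow_one] at h₁
  exact one_ne_zero (congrArg Heis.k h₁)

theorem ZMod.pow_val_add {G : Type*} [Monoid G] {n : ℕ} [NeZero n] {g : G} (hg : g ^ n = 1)
    (i j : ZMod n) : g ^ (i + j).val = g ^ i.val * g ^ j.val := by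
  rw [ZMod.val_add, ← pow_eq_pow_mod _ hg, pow_add]

theorem ZMod.pow_val_mul {G : Type*} [Monoid G] {n : ℕ} {g : G} (hg : g ^ n = 1)
    (i j : ZMod n) : g ^ (i * j).val = g ^ (i.val * j.val) := by
  rw [ZMod.val_mul, ← pow_eq_pow_mod _ hg]

theorem pow_mul_pow_of_mul_eq {G : Type*} [Monoid G] {u v w : G} (huv : Commute u v)
    (huw : Commute u w) (h : w * v = u * v * w) (i j : ℕ) :
    w ^ i * v ^ j = u ^ (i * j) * v ^ j * w ^ i := by
  have h₁ (j : ℕ) : w * v ^ j = u ^ j * v ^ j * w := by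
    induction j with
    | zero => simp
    | succ j ih =>
      rw [pow_succ v, ← mul_assoc, ih, mul_assoc _ w, h, pow_succ u]
      simp only [mul_assoc]
      rw [← mul_assoc (v ^ j), ← (huv.pow_right j).eq]
      simp only [mul_assoc]
  induction i with
  | zero => simp
  | succ i ih =>
    rw [pow_succ' w, mul_assoc, ih, ← mul_assoc, ← mul_assoc, ← (huw.pow_left _).eq,
      mul_assoc _ w, h₁, add_one_mul, pow_add]
    simp only [mul_assoc]

/-- The homomorphism from the Heisenberg group over `ZMod n` determined by three elements
that satisfy its defining relations. -/
def Heis.lift {G : Type*} [Group G] {n : ℕ} [NeZero n] {u v w : G} (hu : u ^ n = 1)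
    (hv : v ^ n = 1) (hw : w ^ n = 1) (huv : Commute u v) (huw : Commute u w)
    (h : w * v = u * v * w) : Heis (ZMod n) →* G :=
  MonoidHom.mk' (fun x => u ^ x.k.val * v ^ x.a.val * w ^ x.c.val) fun x y => by
    simp only [Heis.mul_k, Heis.mul_a, Heis.mul_c, ZMod.pow_val_add hu, ZMod.pow_val_add hv,
      ZMod.pow_val_add hw, ZMod.pow_val_mul hu]
    have h₁ := pow_mul_pow_of_mul_eq huv huw h x.c.val y.a.val
    have h₂ := (huw.pow_pow y.k.val x.c.val).eq
    have h₃ := (huv.pow_pow y.k.val x.a.val).eq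
    have h₄ := (huv.pow_pow (x.c.val * y.a.val) x.a.val).eq
    generalize u ^ (x.c.val * y.a.val) = s at *
    generalize u ^ y.k.val = t at *
    generalize w ^ x.c.val = p at *
    generalize v ^ x.a.val = q at *
    generalize v ^ y.a.val = r at *
    calc _ = u ^ x.k.val * t * (s * q) * r * p * w ^ y.c.val := by simp only [mul_assoc]
      _ = u ^ x.k.val * (t * q) * (s * r * p) * w ^ y.c.val := by
        rw [h₄]; simp only [mul_assoc]
      _ = u ^ x.k.val * q * (t * p) * r * w ^ y.c.val := by
        rw [h₃, ← h₁]; simp only [mul_assoc]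
      _ = _ := by rw [h₂]; simp only [mul_assoc]

/-- The parametrization of `Gsub` by the Heisenberg group over `GF(3)`. -/
def heisHom : Heis (ZMod 3) →* GL (Fin 6) (ZMod 2) :=
  Heis.lift (n := 3) (u := M1 * M2⁻¹) (v := M1) (w := M3)
    (Units.ext (by decide +kernel)) (Units.ext (by decide +kernel))
    (Units.ext (by decide +kernel)) (Units.ext (by decide +kernel))
    (Units.ext (by decide +kernel)) (Units.ext (by decide +kernel))

theorem heisHom_range : heisHom.range = Gsub := by
  have h₁ : M1 ∈ Gsub := Subgroup.subset_closure (by simp)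
  have h₂ : M2 ∈ Gsub := Subgroup.subset_closure (by simp)
  have h₃ : M3 ∈ Gsub := Subgroup.subset_closure (by simp)
  apply le_antisymm
  · rintro _ ⟨x, rfl⟩
    exact mul_mem (mul_mem (pow_mem (mul_mem h₁ (inv_mem h₂)) _) (pow_mem h₁ _)) (pow_mem h₃ _)
  · rw [Gsub, Subgroup.closure_le]
    rintro _ (rfl | rfl | rfl)
    · exact ⟨⟨0, 1, 0⟩, Units.ext (by decide +kernel)⟩
    · exact ⟨⟨2, 1, 0⟩, Units.ext (by decide +kernel)⟩
    · exact ⟨⟨0, 0, 1⟩, Units.ext (by decide +kernel)⟩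

theorem heisHom_fixed {x : Heis (ZMod 3)}
    (h : vecMul ![1, 0, 1, 0, 0, 0] (heisHom x : Matrix (Fin 6) (Fin 6) (ZMod 2)) =
      ![1, 0, 1, 0, 0, 0]) : x = 1 := by
  obtain ⟨k, a, c⟩ := x
  have key : ∀ k a c : ZMod 3,
      vecMul ![1, 0, 1, 0, 0, 0] (heisHom ⟨k, a, c⟩ : Matrix (Fin 6) (Fin 6) (ZMod 2)) =
        ![1, 0, 1, 0, 0, 0] → k = 0 ∧ a = 0 ∧ c = 0 := by
    decide +kernel
  obtain ⟨rfl, rfl, rfl⟩ := key k a c h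
  rfl

theorem heisHom_injective : Function.Injective heisHom := by
  rw [injective_iff_map_eq_one]
  intro x hx
  apply heisHom_fixed
  simp [hx]

/-- `Gsub` is the Heisenberg group over `GF(3)`. -/
noncomputable def heisEquiv : Heis (ZMod 3) ≃* Gsub :=
  (MonoidHom.ofInjective heisHom_injective).trans (MulEquiv.subgroupCongr heisHom_range)

theorem Qform_vecMul {g : GL (Fin 6) (ZMod 2)} (hg : g ∈ Gsub) (v : Fin 6 → ZMod 2) :
    Qform (vecMul v (g : Matrix (Fin 6) (Fin 6) (ZMod 2))) = Qform v := by
  induction hg using Subgroup.closure_induction generalizing v with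
  | mem x hx =>
    revert v
    obtain rfl | rfl | rfl := hx <;> decide +kernel
  | one => simp
  | mul x y _ _ hx hy => rw [Units.val_mul, ← vecMul_vecMul, hy, hx]
  | inv x _ hx =>
    rw [← hx, vecMul_vecMul, ← Units.val_mul, inv_mul_cancel, Units.val_one, vecMul_one]

theorem natCard_singular : Nat.card {v : Fin 6 → ZMod 2 | v ≠ 0 ∧ Qform v = 0} = 27 := by
  rw [Set.coe_ofPred, Nat.card_eq_fintype_card, Fintype.card_subtype]
  decide +kernel

theorem natCard_Gsub : Nat.card Gsub = 27 := by
  rw [← Nat.card_congr heisEquiv.toEquiv, Heis.natCard, Nat.card_zmod]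
  rfl

theorem eq_one_of_fixes_base {g : GL (Fin 6) (ZMod 2)} (hg : g ∈ Gsub)
    (h : vecMul ![1, 0, 1, 0, 0, 0] (g : Matrix (Fin 6) (Fin 6) (ZMod 2)) =
      ![1, 0, 1, 0, 0, 0]) : g = 1 := by
  rw [← heisHom_range] at hg
  obtain ⟨x, rfl⟩ := hg
  rw [heisHom_fixed h, map_one]

theorem exists_vecMul_base_eq {v : Fin 6 → ZMod 2} (hv : v ≠ 0) (hQ : Qform v = 0) :
    ∃ g ∈ Gsub, vecMul ![1, 0, 1, 0, 0, 0] (g : Matrix (Fin 6) (Fin 6) (ZMod 2)) = v := by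
  let f : Gsub → {v : Fin 6 → ZMod 2 | v ≠ 0 ∧ Qform v = 0} := fun g =>
    ⟨vecMul ![1, 0, 1, 0, 0, 0] (g.1 : Matrix (Fin 6) (Fin 6) (ZMod 2)), fun h => by
      have h₀ := congrArg
        (vecMul · ((g.1⁻¹ : GL (Fin 6) (ZMod 2)) : Matrix (Fin 6) (Fin 6) (ZMod 2))) h
      simp only [vecMul_vecMul, ← Units.val_mul, mul_inv_cancel, Units.val_one, vecMul_one,
        zero_vecMul] at h₀
      exact absurd h₀ (by decide), by
      rw [Qform_vecMul g.2]; decide⟩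
  have hf : Function.Injective f := by
    intro g h hgh
    have hgh := congrArg
      (vecMul · ((h.1⁻¹ : GL (Fin 6) (ZMod 2)) : Matrix (Fin 6) (Fin 6) (ZMod 2)))
      (congrArg Subtype.val hgh)
    simp only [f, vecMul_vecMul, ← Units.val_mul, mul_inv_cancel, Units.val_one,
      vecMul_one] at hgh
    exact Subtype.ext (mul_inv_eq_one.1 (eq_one_of_fixes_base (mul_mem g.2 (inv_mem h.2)) hgh))
  obtain ⟨g, hg⟩ := ((Nat.bijective_iff_injective_and_card f).2
    ⟨hf, natCard_Gsub.trans natCard_singular.symm⟩).2 ⟨v, hv, hQ⟩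
  exact ⟨g, g.2, congrArg Subtype.val hg⟩

theorem map_center_mulEquiv {G H : Type*} [Group G] [Group H] (e : G ≃* H) :
    (Subgroup.center G).map e.toMonoidHom = Subgroup.center H := by
  ext y
  obtain ⟨x, rfl⟩ := e.surjective y
  simp [Subgroup.mem_center_iff, e.surjective.forall, ← map_mul]

theorem map_frattini_mulEquiv {G H : Type*} [Group G] [Group H] (e : G ≃* H) :
    (frattini G).map e.toMonoidHom = frattini H :=
  e.mapSubgroup.map_radical

theorem map_commutator_mulEquiv {G H : Type*} [Group G] [Group H] (e : G ≃* H) :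
    (commutator G).map e.toMonoidHom = commutator H := by
  rw [commutator_def, Subgroup.map_commutator, Subgroup.map_top_of_surjective _ e.surjective]
  rfl

theorem map_subtype_commutator {G : Type*} [Group G] (H : Subgroup G) :
    (commutator H).map H.subtype = ⁅H, H⁆ := by
  rw [commutator_def, Subgroup.map_commutator, ← MonoidHom.range_eq_map, Subgroup.range_subtype]

theorem center_Gsub : Subgroup.center Gsub = commutator Gsub := by
  rw [← map_center_mulEquiv heisEquiv, ← Heis.commutator_eq_center, map_commutator_mulEquiv]

theorem frattini_Gsub : frattini Gsub = commutator Gsub := by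
  rw [← map_frattini_mulEquiv heisEquiv, Heis.frattini_eq_center, ← Heis.commutator_eq_center,
    map_commutator_mulEquiv]

/-- `G` is extraspecial of order 27 and exponent 3, every element of `G` preserves `Q`,
and `G` acts freely and transitively on the 27 nonzero singular vectors of `Q`,
the points of `Q⁻(5,2)`. -/
theorem Gsub_extraspecial_regular :
    Nat.card Gsub = 27 ∧
    Monoid.exponent Gsub = 3 ∧
    Subgroup.map Gsub.subtype (Subgroup.center Gsub) = ⁅Gsub, Gsub⁆ ∧
    Subgroup.map Gsub.subtype (frattini Gsub) = ⁅Gsub, Gsub⁆ ∧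
    Nat.card (Subgroup.center Gsub) = 3 ∧
    (∀ g ∈ Gsub, ∀ v : Fin 6 → ZMod 2,
      Qform (Matrix.vecMul v (g : Matrix (Fin 6) (Fin 6) (ZMod 2))) = Qform v) ∧
    Nat.card {v : Fin 6 → ZMod 2 | v ≠ 0 ∧ Qform v = 0} = 27 ∧
    (∀ v : Fin 6 → ZMod 2, v ≠ 0 → Qform v = 0 →
      ∀ w : Fin 6 → ZMod 2, w ≠ 0 → Qform w = 0 →
        ∃ g ∈ Gsub, Matrix.vecMul v (g : Matrix (Fin 6) (Fin 6) (ZMod 2)) = w) ∧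
    (∀ g ∈ Gsub,
      (∃ v : Fin 6 → ZMod 2, v ≠ 0 ∧ Qform v = 0 ∧
        Matrix.vecMul v (g : Matrix (Fin 6) (Fin 6) (ZMod 2)) = v) → g = 1) := by
  refine ⟨natCard_Gsub, ?_, ?_, ?_, ?_, fun g hg => Qform_vecMul hg, natCard_singular, ?_, ?_⟩
  · rw [← Monoid.exponent_eq_of_mulEquiv heisEquiv, Heis.exponent_three]
  · rw [center_Gsub, map_subtype_commutator]
  · rw [frattini_Gsub, map_subtype_commutator]
  · rw [← Nat.card_congr (Subgroup.centerCongr heisEquiv).toEquiv, Heis.natCard_center,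
      Nat.card_zmod]
  · intro v hv hQv w hw hQw
    obtain ⟨g, hg, rfl⟩ := exists_vecMul_base_eq hv hQv
    obtain ⟨h, hh, rfl⟩ := exists_vecMul_base_eq hw hQw
    refine ⟨g⁻¹ * h, mul_mem (inv_mem hg) hh, ?_⟩
    rw [vecMul_vecMul, ← Units.val_mul, mul_inv_cancel_left]
  · rintro g hg ⟨v, hv, hQ, hfix⟩
    obtain ⟨h, hh, rfl⟩ := exists_vecMul_base_eq hv hQ
    have hfix := congrArg
      (vecMul · ((h⁻¹ : GL (Fin 6) (ZMod 2)) : Matrix (Fin 6) (Fin 6) (ZMod 2))) hfix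
    simp only [vecMul_vecMul, ← Units.val_mul, mul_inv_cancel, Units.val_one,
      vecMul_one] at hfix
    exact conj_eq_one_iff.1
      (eq_one_of_fixes_base (mul_mem (mul_mem hh hg) (inv_mem hh)) hfix)
end
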